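/- The set X_2(K) is nonempty, and the zero-dimensional scheme X_2 has length (n−1)(n−2)/2; concretely, there exists d_0 such that for every d ≥ d_0, the K-dimension of the degree-d homogeneous component of K[x_0,x_1,x_2]/I_{X_2} equals (n−1)(n−2)/2. -/

import Mathlib

open MvPolynomial

noncomputable section

/-- The coefficient `a_i` of `s^(n-i) t^i` in a binary form `f` of degree `n`. -/
def bcoeff {K : Type*} [Field K] (n : ℕ) (f : MvPolynomial (Fin 2) K) (i : Fin (n + 1)) : K :=
  MvPolynomial.coeff (Finsupp.single 0 (n - (i : ℕ)) + Finsupp.single 1 (i : ℕ)) f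

/-- The binary form of degree `k` with coefficient vector `x`. -/
def formOf {K : Type*} [Field K] (k : ℕ) (x : Fin (k + 1) → K) : MvPolynomial (Fin 2) K :=
  ∑ i : Fin (k + 1),
    MvPolynomial.C (x i) * MvPolynomial.X 0 ^ (k - (i : ℕ)) * MvPolynomial.X 1 ^ (i : ℕ)

/-- The matrix `M_k` associated to the parameterization `f`: the first `n-k+1` rows contain
the variables `x_0, …, x_k` in staircase position, the last three rows are the coefficient
vectors of `f_0, f_1, f_2`. -/
def Mmat {K : Type*} [Field K] (n k : ℕ) (f : Fin 3 → MvPolynomial (Fin 2) K) :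
    Matrix (Fin (n - k + 4)) (Fin (n + 1)) (MvPolynomial (Fin (k + 1)) K) :=
  fun j c =>
    if hj : (j : ℕ) ≤ n - k then
      if h : (j : ℕ) ≤ (c : ℕ) ∧ (c : ℕ) ≤ (j : ℕ) + k then
        MvPolynomial.X ⟨(c : ℕ) - (j : ℕ), by omega⟩
      else 0
    else
      MvPolynomial.C (bcoeff n (f ⟨(j : ℕ) - (n - k + 1), by have := j.isLt; omega⟩) c)

/-- The set of `(n-k+3) × (n-k+3)` minors of the matrix `M_k`; it generates the ideal
`I_{X_k}`. -/
def minorsSet {K : Type*} [Field K] (n k : ℕ) (f : Fin 3 → MvPolynomial (Fin 2) K) :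
    Set (MvPolynomial (Fin (k + 1)) K) :=
  { g | ∃ (r : Fin (n - k + 3) → Fin (n - k + 4)) (c : Fin (n - k + 3) → Fin (n + 1)),
      Function.Injective r ∧ Function.Injective c ∧
      g = ((Mmat n k f).submatrix r c).det }

/-- The projective zero locus `X_k(K) ⊆ ℙ^k(K)` of the ideal of minors of `M_k`. -/
def XkSet {K : Type*} [Field K] (n k : ℕ) (f : Fin 3 → MvPolynomial (Fin 2) K) :
    Set (Projectivization K (Fin (k + 1) → K)) :=
  { P | ∀ g ∈ minorsSet n k f, MvPolynomial.eval P.rep g = 0 }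

/-- Evaluation of the parameterization at a vector `v ∈ K²`. -/
def evalVec {K : Type*} [Field K] (f : Fin 3 → MvPolynomial (Fin 2) K) (v : Fin 2 → K) :
    Fin 3 → K :=
  fun u => MvPolynomial.eval v (f u)

/-- The induced map `f : ℙ¹(K) → ℙ²(K)` (with a junk value where undefined). -/
def projMap {K : Type*} [Field K] (f : Fin 3 → MvPolynomial (Fin 2) K)
    (P : Projectivization K (Fin 2 → K)) : Projectivization K (Fin 3 → K) :=
  haveI := Classical.propDecidable (evalVec f P.rep ≠ 0)
  if h : evalVec f P.rep ≠ 0 then Projectivization.mk K _ h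
  else Projectivization.mk K (fun _ => 1) (fun hc => one_ne_zero (congrFun hc 0))

/-- `f = (f_0, f_1, f_2)` is a proper parameterization of degree `n`: the `f_u` are
homogeneous of degree `n`, have no common zero outside the origin, and the induced map
`ℙ¹(K) → ℙ²(K)` is injective outside some finite set. -/
structure IsProperParam {K : Type*} [Field K] (n : ℕ)
    (f : Fin 3 → MvPolynomial (Fin 2) K) : Prop where
  homog : ∀ u, (f u).IsHomogeneous n
  no_common_zero : ∀ v : Fin 2 → K, v ≠ 0 → evalVec f v ≠ 0
  gen_injective : ∃ S : Set (Projectivization K (Fin 2 → K)), S.Finite ∧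
    Set.InjOn (projMap f) Sᶜ

/-- The homogeneous vanishing ideal of the point `p ∈ ℙ²(K)`. -/
def pointIdeal {K : Type*} [Field K] (p : Fin 3 → K) : Ideal (MvPolynomial (Fin 3) K) :=
  Ideal.span { L | L.IsHomogeneous 1 ∧ MvPolynomial.eval p L = 0 }

/-- The multiplicity of the curve `{F = 0}` at the point `p`:
the largest `m` with `F ∈ I(p)^m`. -/
def multAt {K : Type*} [Field K] (F : MvPolynomial (Fin 3) K) (p : Fin 3 → K) : ℕ :=
  sSup { m | F ∈ pointIdeal p ^ m }

/-- The cross difference `p_i f_j - p_j f_i`. -/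
def crossDiff {K : Type*} [Field K] (f : Fin 3 → MvPolynomial (Fin 2) K) (p : Fin 3 → K)
    (i j : Fin 3) : MvPolynomial (Fin 2) K :=
  MvPolynomial.C (p i) * f j - MvPolynomial.C (p j) * f i

/-- `G` is a greatest common divisor of the three cross differences `p_i f_j - p_j f_i`,
`0 ≤ i < j ≤ 2`. -/
def IsGcdOfCross {K : Type*} [Field K] (f : Fin 3 → MvPolynomial (Fin 2) K) (p : Fin 3 → K)
    (G : MvPolynomial (Fin 2) K) : Prop :=
  (∀ i j : Fin 3, i < j → G ∣ crossDiff f p i j) ∧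
  (∀ D : MvPolynomial (Fin 2) K, (∀ i j : Fin 3, i < j → D ∣ crossDiff f p i j) → D ∣ G)

/-- The linear binary form with root `v = (v 0 : v 1)`. -/
def linFormOf {K : Type*} [Field K] (v : Fin 2 → K) : MvPolynomial (Fin 2) K :=
  MvPolynomial.C (v 1) * MvPolynomial.X 0 - MvPolynomial.C (v 0) * MvPolynomial.X 1

/-- The multiplicity of `v` as a root of the binary form `h`. -/
def ordAt {K : Type*} [Field K] (v : Fin 2 → K) (h : MvPolynomial (Fin 2) K) : ℕ :=
  sSup { e | linFormOf v ^ e ∣ h }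

/-- The point `x ∈ ℙ²` lies on the conic `4 x₀ x₂ - x₁² = 0`. -/
def onConic {K : Type*} [Field K] (x : Fin 3 → K) : Prop :=
  4 * x 0 * x 2 - x 1 ^ 2 = 0


/-- signed maximal minors -/
noncomputable def sMinor {R : Type*} [CommRing R] {N : ℕ} (A : Matrix (Fin (N+1)) (Fin N) R) (i : Fin (N+1)) : R :=
  (-1) ^ (i : ℕ) * (A.submatrix i.succAbove id).det

theorem sMinor_sum {R : Type*} [CommRing R] {N : ℕ} (A : Matrix (Fin (N+1)) (Fin N) R)
    (z : Fin N → R) : ∑ i, sMinor A i * (A.mulVec z) i = 0 := by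
  have key : ∀ j, ∑ i, sMinor A i * A i j = 0 := by
    intro j
    let B : Matrix (Fin (N+1)) (Fin (N+1)) R := fun i => Fin.cons (α := fun _ => R) (A i j) (A i)
    have hB : B.det = 0 := by
      refine Matrix.det_zero_of_column_eq (i := 0) (j := j.succ) (Fin.succ_ne_zero j).symm ?_
      intro k; simp [B]
    rw [Matrix.det_succ_column_zero] at hB
    rw [← hB]
    refine Finset.sum_congr rfl fun i _ => ?_
    have : B.submatrix i.succAbove Fin.succ = A.submatrix i.succAbove id := by
      ext a b; rfl
    rw [this]; simp [B, sMinor]; ring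
  simp only [Matrix.mulVec, dotProduct, Finset.mul_sum]
  rw [Finset.sum_comm]
  refine Finset.sum_eq_zero fun j _ => ?_
  have := key j
  simp only [← mul_assoc]
  rw [← Finset.sum_mul, this, zero_mul]

theorem mulVec_inj_of_sMinor {R : Type*} [CommRing R] [IsDomain R] {N : ℕ}
    (A : Matrix (Fin (N+1)) (Fin N) R) (i : Fin (N+1)) (hi : sMinor A i ≠ 0) (z : Fin N → R)
    (hz : A.mulVec z = 0) : z = 0 := by
  have hd : (A.submatrix i.succAbove id).det ≠ 0 := fun h => hi (by simp [sMinor, h])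
  refine Matrix.eq_zero_of_mulVec_eq_zero hd ?_
  ext k
  exact congrFun hz (i.succAbove k)

theorem cramer_aux {R : Type*} [CommRing R] [IsDomain R] {N : ℕ}
    (A : Matrix (Fin (N+1)) (Fin N) R) (i : Fin (N+1)) (hi : sMinor A i ≠ 0) (y : Fin (N+1) → R)
    (hy : ∑ i, sMinor A i * y i = 0) : ∃ z, A.mulVec z = sMinor A i • y := by
  let B := A.submatrix i.succAbove id
  let z : Fin N → R := (-1) ^ (i : ℕ) • B.adjugate.mulVec (fun k => y (i.succAbove k))
  refine ⟨z, ?_⟩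
  have h1 : ∀ k, (A.mulVec z) (i.succAbove k) = sMinor A i * y (i.succAbove k) := by
    intro k
    have : B.mulVec z = (sMinor A i) • (fun k => y (i.succAbove k)) := by
      simp only [z, Matrix.mulVec_smul, Matrix.mulVec_mulVec, Matrix.mul_adjugate, Matrix.smul_mulVec,
        Matrix.one_mulVec, sMinor, B]
      ext k; simp [mul_assoc]
    exact congrFun this k
  have h2 : ∑ k, sMinor A k * ((A.mulVec z) k - sMinor A i * y k) = 0 := by
    simp only [mul_sub, Finset.sum_sub_distrib, sMinor_sum, zero_sub, neg_eq_zero]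
    rw [← mul_zero (sMinor A i), ← hy, Finset.mul_sum]
    exact Finset.sum_congr rfl fun k _ => by ring
  rw [Fin.sum_univ_succAbove _ i] at h2
  simp only [h1, sub_self, mul_zero, Finset.sum_const_zero, add_zero, mul_eq_zero, hi, false_or] at h2
  ext k
  rcases Fin.eq_self_or_eq_succAbove i k with rfl | ⟨k, rfl⟩
  · simpa [sub_eq_zero] using h2
  · simpa using h1 k

theorem dvd_of_forall_dvd {R ι : Type*} [CommRing R] [IsDomain R] [UniqueFactorizationMonoid R]
    (Δ : ι → R) (hΔ : ∀ p, Prime p → ∃ k, ¬ p ∣ Δ k) (D : R) (hD : D ≠ 0) :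
    ∀ z, (∀ k, D ∣ Δ k * z) → D ∣ z := by
  induction D using UniqueFactorizationMonoid.induction_on_prime with
  | h₁ => exact absurd rfl hD
  | h₂ x hx => intro z _; exact hx.dvd
  | h₃ a p ha hp ih =>
    intro z hz
    obtain ⟨z', rfl⟩ := ih ha z fun k => (Dvd.intro_left p rfl).trans (hz k)
    obtain ⟨k, hk⟩ := hΔ p hp
    have := hz k
    rw [show Δ k * (a * z') = (Δ k * z') * a by ring] at this
    have h3 := (hp.dvd_or_dvd ((mul_dvd_mul_iff_right ha).1 this)).resolve_left hk
    rw [mul_comm]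
    exact mul_dvd_mul_left _ h3

theorem hb_exact {R : Type*} [CommRing R] [IsDomain R] [UniqueFactorizationMonoid R] {N : ℕ}
    (A : Matrix (Fin (N+1)) (Fin N) R) (hne : ∃ i, sMinor A i ≠ 0)
    (hΔ : ∀ p, Prime p → ∃ k, ¬ p ∣ sMinor A k)
    (y : Fin (N+1) → R)
    (hy : ∑ i, sMinor A i * y i = 0) : ∃ z, A.mulVec z = y := by
  obtain ⟨i, hi⟩ := hne
  obtain ⟨w, hw⟩ := cramer_aux A i hi y hy
  have : ∀ j, sMinor A i ∣ w j := by
    intro j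
    refine dvd_of_forall_dvd (sMinor A) hΔ _ hi _ fun k => ?_
    by_cases hk : sMinor A k = 0
    · simp [hk]
    obtain ⟨w', hw'⟩ := cramer_aux A k hk y hy
    have h0 : A.mulVec (sMinor A k • w - sMinor A i • w') = 0 := by
      rw [Matrix.mulVec_sub, Matrix.mulVec_smul, Matrix.mulVec_smul, hw, hw', smul_smul, smul_smul, mul_comm, sub_self]
    have := congrFun (mulVec_inj_of_sMinor A i hi _ h0) j
    simp [sub_eq_zero] at this
    rw [this]
    exact dvd_mul_right _ _
  choose z hz using this
  refine ⟨z, ?_⟩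
  have hwz : w = sMinor A i • z := by ext j; simp [hz j]
  rw [hwz, Matrix.mulVec_smul] at hw
  exact smul_right_injective _ hi hw

theorem finrank_homog {K : Type*} [Field K] (d : ℕ) :
    Module.finrank K (homogeneousSubmodule (Fin 3) K d) = (d + 2).choose 2 := by
  rw [homogeneousSubmodule_eq_finsupp_supported]
  have hset : {d' : Fin 3 →₀ ℕ | Finsupp.degree d' = d} =
      ((Finset.univ.finsuppAntidiag d : Finset (Fin 3 →₀ ℕ)) : Set (Fin 3 →₀ ℕ)) := by
    ext x; simp [Finset.mem_finsuppAntidiag, Finsupp.degree_eq_sum]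
  rw [(AddMonoidAlgebra.supportedEquivFinsupp _).finrank_eq, hset]
  rw [Module.finrank_finsupp_self]
  rw [← Set.toFinset_card, Finset.toFinset_coe, Finset.card_finsuppAntidiag_nat_eq_choose]
  simp only [Finset.card_univ, Fintype.card_fin]
  rw [show 3 + d - 1 = d + 2 by omega, Nat.choose_symm_add]

instance {K : Type*} [Field K] (d : ℕ) : Module.Finite K (homogeneousSubmodule (Fin 3) K d) :=
  Module.Finite.iff_fg.2 (homogeneousSubmodule_fg (Fin 3) K d)

theorem homComp_mul {K σ : Type*} [Field K] {a : MvPolynomial σ K} {k : ℕ} (ha : a.IsHomogeneous k)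
    (b : MvPolynomial σ K) (l : ℕ) :
    homogeneousComponent (k + l) (a * b) = a * homogeneousComponent l b := by
  conv_lhs => rw [← sum_homogeneousComponent b]
  rw [Finset.mul_sum, map_sum]
  have : ∀ i, homogeneousComponent (k + l) (a * homogeneousComponent i b)
      = if i = l then a * homogeneousComponent l b else 0 := by
    intro i
    rw [homogeneousComponent_of_mem (n := k + i)]
    · by_cases h : i = l
      · simp [h]
      · rw [if_neg (by omega), if_neg h]
    · exact ha.mul (homogeneousComponent_isHomogeneous i b)
  simp only [this]
  rw [Finset.sum_ite_eq']
  split_ifs with h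
  · rfl
  · rw [homogeneousComponent_eq_zero, mul_zero]
    simpa using h

theorem dim_count {K : Type*} [Field K] {N D : ℕ}
    (A : Matrix (Fin (N+1)) (Fin N) (MvPolynomial (Fin 3) K)) (ε δ : Fin (N+1) → ℕ)
    (hA : ∀ i j, (A i j).IsHomogeneous (ε i)) (hS : ∀ i, (sMinor A i).IsHomogeneous (δ i))
    (hD : ∀ i, δ i + ε i = D)
    (hne : ∃ i, sMinor A i ≠ 0) (hΔ : ∀ p, Prime p → ∃ k, ¬ p ∣ sMinor A k) (e : ℕ) :
    Module.finrank K (Submodule.span K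
        ((Ideal.Quotient.mk (Ideal.span (Set.range (sMinor A)))) ''
          { g : MvPolynomial (Fin 3) K | g.IsHomogeneous (e + D) })) + ∑ i, (e + ε i + 2).choose 2
      = (e + D + 2).choose 2 + N * (e + 2).choose 2 := by
  set I := Ideal.span (Set.range (sMinor A)) with hI
  let H := fun k => homogeneousSubmodule (Fin 3) K k
  -- the quotient map on H_d
  let q : H (e + D) →ₗ[K] (MvPolynomial (Fin 3) K ⧸ I) :=
    (Ideal.Quotient.mkₐ K I).toLinearMap ∘ₗ (H (e + D)).subtype
  have hq : Submodule.span K ((Ideal.Quotient.mk I) ''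
          { g : MvPolynomial (Fin 3) K | g.IsHomogeneous (e + D) }) = LinearMap.range q := by
    have : LinearMap.range q = (H (e+D)).map (Ideal.Quotient.mkₐ K I).toLinearMap := by
      rw [LinearMap.range_comp, Submodule.range_subtype]
    rw [this]
    have h2 : ((Ideal.Quotient.mk I) '' { g : MvPolynomial (Fin 3) K | g.IsHomogeneous (e + D) })
      = ((H (e+D)).map (Ideal.Quotient.mkₐ K I).toLinearMap : Set _) := rfl
    rw [h2, Submodule.span_eq]
  let φ : (Fin N → H e) →ₗ[K] (Π i, H (e + ε i)) :=
    LinearMap.pi fun i => LinearMap.codRestrict (H (e + ε i))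
      (∑ j, (LinearMap.mulLeft K (A i j)) ∘ₗ (H e).subtype ∘ₗ LinearMap.proj j) (by
        intro z
        simp only [LinearMap.sum_apply]
        refine Submodule.sum_mem _ fun j _ => ?_
        rw [add_comm]
        exact (hA i j).mul (z j).2)
  let ψ : (Π i, H (e + ε i)) →ₗ[K] H (e + D) :=
    LinearMap.codRestrict (H (e + D))
      (∑ i, (LinearMap.mulLeft K (sMinor A i)) ∘ₗ (H (e + ε i)).subtype ∘ₗ LinearMap.proj i) (by
        intro z
        simp only [LinearMap.sum_apply]
        refine Submodule.sum_mem _ fun i _ => ?_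
        rw [show e + D = δ i + (e + ε i) by rw [← hD i]; ring]
        exact (hS i).mul (z i).2)
  have hφ : ∀ z i, ((φ z i : H (e + ε i)) : MvPolynomial (Fin 3) K) = A.mulVec (fun j => (z j : MvPolynomial (Fin 3) K)) i := by
    intro z i
    simp [φ, Matrix.mulVec, dotProduct]
  have hψ : ∀ y, ((ψ y : H (e + D)) : MvPolynomial (Fin 3) K) = ∑ i, sMinor A i * (y i : MvPolynomial (Fin 3) K) := by
    intro y
    simp [ψ]
  have hφker : LinearMap.ker φ = ⊥ := by
    rw [LinearMap.ker_eq_bot']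
    intro z hz
    obtain ⟨i, hi⟩ := hne
    have := mulVec_inj_of_sMinor A i hi (fun j => (z j : MvPolynomial (Fin 3) K)) (by
      ext1 k
      rw [← hφ, hz]; rfl)
    ext1 j
    exact Subtype.ext (congrFun this j)
  have hex : LinearMap.ker ψ = LinearMap.range φ := by
    apply le_antisymm
    · intro y hy
      have hy' : ∑ i, sMinor A i * (y i : MvPolynomial (Fin 3) K) = 0 := by
        rw [← hψ, LinearMap.mem_ker.1 hy]; rfl
      obtain ⟨z, hz⟩ := hb_exact A hne hΔ _ hy'
      refine ⟨fun j => ⟨homogeneousComponent e (z j), homogeneousComponent_isHomogeneous _ _⟩, ?_⟩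
      ext1 i
      apply Subtype.ext
      rw [hφ]
      have h1 := congrArg (homogeneousComponent (ε i + e)) (congrFun hz i)
      rw [homogeneousComponent_of_mem (y i).2, if_pos (add_comm _ _)] at h1
      rw [← h1]
      simp only [Matrix.mulVec, dotProduct, map_sum]
      exact Finset.sum_congr rfl fun j _ => (homComp_mul (hA i j) _ _).symm
    · rintro _ ⟨z, rfl⟩
      rw [LinearMap.mem_ker]
      apply Subtype.ext
      rw [hψ]
      simp only [hφ]
      exact sMinor_sum A _
  have hrange : LinearMap.ker q = LinearMap.range ψ := by
    apply le_antisymm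
    · intro g hg
      have hg' : (g : MvPolynomial (Fin 3) K) ∈ I := by
        rw [← Ideal.Quotient.eq_zero_iff_mem]; exact hg
      rw [hI, Ideal.mem_span_range_iff_exists_fun] at hg'
      obtain ⟨c, hc⟩ := hg'
      refine ⟨fun i => ⟨homogeneousComponent (e + ε i) (c i), homogeneousComponent_isHomogeneous _ _⟩, ?_⟩
      apply Subtype.ext
      rw [hψ]
      have h1 := congrArg (homogeneousComponent (e + D)) hc
      rw [homogeneousComponent_of_mem g.2, if_pos rfl] at h1
      rw [← h1, map_sum]
      refine Finset.sum_congr rfl fun i _ => ?_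
      rw [mul_comm (c i), show e + D = δ i + (e + ε i) by rw [← hD i]; ring, homComp_mul (hS i)]
    · rintro _ ⟨y, rfl⟩
      rw [LinearMap.mem_ker]
      change Ideal.Quotient.mk I _ = 0
      rw [Ideal.Quotient.eq_zero_iff_mem]
      change ((ψ y : H (e + D)) : MvPolynomial (Fin 3) K) ∈ I
      rw [hψ]
      refine Ideal.sum_mem _ fun i _ => Ideal.mul_mem_right _ _ (Ideal.subset_span ⟨i, rfl⟩)
  have r1 := LinearMap.finrank_range_add_finrank_ker q
  have r2 := LinearMap.finrank_range_add_finrank_ker ψ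
  have r3 := LinearMap.finrank_range_add_finrank_ker φ
  rw [hφker, finrank_bot, ← hex] at r3
  rw [hrange] at r1
  rw [Module.finrank_pi_fintype] at r2 r3
  simp only [H, finrank_homog, Finset.sum_const, Finset.card_univ, Fintype.card_fin, smul_eq_mul] at r1 r2 r3
  rw [hq]
  omega

theorem homog_eval_smul {K σ : Type*} [Field K] [Fintype σ] {P : MvPolynomial σ K} {e : ℕ}
    (hP : P.IsHomogeneous e) (t : K) (v : σ → K) : eval (t • v) P = t ^ e * eval v P := by
  rw [eval_eq', eval_eq', Finset.mul_sum]
  refine Finset.sum_congr rfl fun d hd => ?_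
  have hdeg : ∑ i, d i = e := by
    rw [← Finsupp.degree_eq_sum]
    by_contra h
    exact (mem_support_iff.1 hd) (hP.coeff_eq_zero h)
  simp only [Pi.smul_apply, smul_eq_mul, mul_pow, Finset.prod_mul_distrib, Finset.prod_pow_eq_pow_sum, hdeg]
  ring

theorem top_dvd {K σ : Type*} [Field K] {F p : MvPolynomial σ K} {D : ℕ}
    (hF : F.IsHomogeneous D) (h : p ∣ F) : homogeneousComponent p.totalDegree p ∣ F := by
  obtain ⟨q, rfl⟩ := h
  by_cases hp : p = 0
  · simp [hp]
  by_cases hq : q = 0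
  · simp [hq]
  have hD : D = p.totalDegree + q.totalDegree := by
    rw [← totalDegree_mul_of_isDomain hp hq, hF.totalDegree (mul_ne_zero hp hq)]
  refine ⟨homogeneousComponent q.totalDegree q, ?_⟩
  have h1 : homogeneousComponent (p.totalDegree + q.totalDegree) (p * q) = p * q := by
    rw [homogeneousComponent_of_mem hF, if_pos hD.symm]
  rw [← h1]
  have h2 : p * q = ∑ i ∈ Finset.range (p.totalDegree + 1), homogeneousComponent i p * q := by
    rw [← Finset.sum_mul, sum_homogeneousComponent]
  clear h1 hF
  generalize p.totalDegree = a at *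
  rw [h2, map_sum, Finset.sum_eq_single a]
  · exact homComp_mul (homogeneousComponent_isHomogeneous _ _) _ _
  · intro i hi hne
    have hi' : i < a := by
      have := Finset.mem_range.1 hi
      omega
    rw [show a + q.totalDegree = i + (a - i + q.totalDegree) by omega,
      homComp_mul (homogeneousComponent_isHomogeneous _ _),
      homogeneousComponent_eq_zero _ q (by omega), mul_zero]
  · intro h; simp at h

theorem line_zero {K σ : Type*} [Field K] [IsAlgClosed K] [Fintype σ] {P : MvPolynomial σ K} {e : ℕ}
    (hP : P.IsHomogeneous e) (he : e ≠ 0) (u v : σ → K) :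
    ∃ β γ : K, (β ≠ 0 ∨ γ ≠ 0) ∧ eval (β • u + γ • v) P = 0 := by
  let k : (σ → K) → (σ → K) → Polynomial K := fun u v =>
    aeval (fun i => Polynomial.C (u i) + Polynomial.C (v i) * Polynomial.X) P
  have hk : ∀ u v t, (k u v).eval t = eval (u + t • v) P := by
    intro u v t
    simp only [k]
    rw [← Polynomial.coe_evalRingHom, aeval_def, hom_eval₂]
    have : (Polynomial.evalRingHom t).comp (algebraMap K (Polynomial K)) = RingHom.id K := by
      ext x; simp
    rw [this, ← eval₂_id]
    congr 1
    ext i; simp; ring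
  by_cases hv : eval v P = 0
  · exact ⟨0, 1, Or.inr one_ne_zero, by simpa using hv⟩
  by_cases hd : (k u v).degree = 0
  · exfalso
    have hc := Polynomial.eq_C_of_degree_eq_zero hd
    set c := (k u v).coeff 0
    have h2 : k v u - Polynomial.C c * Polynomial.X ^ e = 0 := by
      refine Polynomial.eq_zero_of_infinite_isRoot _ ?_
      refine Set.Infinite.mono (s := {0}ᶜ) ?_ (Set.finite_singleton (0 : K)).infinite_compl
      intro s hs
      have hs : s ≠ 0 := hs
      simp only [Set.mem_ofPred_eq, Polynomial.IsRoot, Polynomial.eval_sub, hk, Polynomial.eval_mul,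
        Polynomial.eval_C, Polynomial.eval_pow, Polynomial.eval_X]
      have h3 : v + s • u = s • (u + s⁻¹ • v) := by
        rw [smul_add, smul_smul, mul_inv_cancel₀ hs, one_smul, add_comm]
      rw [h3, homog_eval_smul hP, ← hk, hc]
      simp; ring
    have h4 := congrArg (Polynomial.eval 0) h2
    simp [hk, he] at h4
    exact hv h4
  · obtain ⟨t, ht⟩ := IsAlgClosed.exists_root _ hd
    refine ⟨1, t, Or.inl one_ne_zero, ?_⟩
    rw [one_smul, ← hk]; exact ht

theorem wronskian_zero {K : Type*} [Field K] [CharZero K] (F G : Polynomial K)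
    (h : F * Polynomial.derivative G = G * Polynomial.derivative F) (a : K) (ha : F.eval a ≠ 0) :
    Polynomial.C (F.eval a) * G = Polynomial.C (G.eval a) * F := by
  set E := Polynomial.C (F.eval a) * G - Polynomial.C (G.eval a) * F with hE
  by_contra hne
  have hE0 : E ≠ 0 := fun h0 => hne (sub_eq_zero.1 h0)
  have hroot : E.IsRoot a := by simp [hE, Polynomial.IsRoot]; ring
  have hW : F * Polynomial.derivative E = E * Polynomial.derivative F := by
    simp only [hE, Polynomial.derivative_sub, Polynomial.derivative_mul, Polynomial.derivative_C]
    linear_combination Polynomial.C (F.eval a) * h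
  have hF0 : F ≠ 0 := fun h => ha (by simp [h])
  have hm := Polynomial.derivative_rootMultiplicity_of_root hroot
  have hpos := (Polynomial.rootMultiplicity_pos hE0).2 hroot
  have hd : (Polynomial.X - Polynomial.C a) ^ (E.rootMultiplicity a) ∣ F * Polynomial.derivative E := by
    rw [hW]; exact (Polynomial.pow_rootMultiplicity_dvd E a).mul_right _
  have hcop : IsCoprime ((Polynomial.X - Polynomial.C a) ^ (E.rootMultiplicity a)) F := by
    apply IsCoprime.pow_left
    refine (Polynomial.irreducible_X_sub_C a).coprime_iff_not_dvd.2 ?_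
    rw [Polynomial.dvd_iff_isRoot]; exact ha
  have hd2 := hcop.dvd_of_dvd_mul_left hd
  have hE' : Polynomial.derivative E ≠ 0 := by
    intro h0
    have := Polynomial.derivative_eq_zero.1 h0
    rw [Polynomial.eq_C_of_natDegree_eq_zero this] at hroot hE0
    simp [Polynomial.IsRoot] at hroot
    simp [hroot] at hE0
  have := (Polynomial.le_rootMultiplicity_iff hE').2 hd2
  omega

theorem parallel_of {K : Type*} [Field K] (v w : Fin 3 → K)
    (h : ∀ u : Fin 3, ∃ c : Fin 3 → K, c ≠ 0 ∧ c u = 0 ∧ ∑ i, c i * v i = 0 ∧ ∑ i, c i * w i = 0) :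
    ∀ i j, v i * w j = v j * w i := by
  have aux : ∀ c0 c1 v0 v1 w0 w1 : K, (c0 ≠ 0 ∨ c1 ≠ 0) → c0 * v0 + c1 * v1 = 0 →
      c0 * w0 + c1 * w1 = 0 → v0 * w1 = v1 * w0 := by
    intro c0 c1 v0 v1 w0 w1 hc h1 h2
    rcases hc with hc | hc
    · apply mul_left_cancel₀ hc; linear_combination w1 * h1 - v1 * h2
    · apply mul_left_cancel₀ hc; linear_combination - w0 * h1 + v0 * h2
  have h01 : v 0 * w 1 = v 1 * w 0 := by
    obtain ⟨c, hc, hu, h1, h2⟩ := h 2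
    simp only [Fin.sum_univ_three, hu, zero_mul, add_zero] at h1 h2
    refine aux _ _ _ _ _ _ ?_ h1 h2
    by_contra! hh
    exact hc (by ext i; fin_cases i <;> simp [hh, hu])
  have h02 : v 0 * w 2 = v 2 * w 0 := by
    obtain ⟨c, hc, hu, h1, h2⟩ := h 1
    simp only [Fin.sum_univ_three, hu, zero_mul, add_zero] at h1 h2
    refine aux _ _ _ _ _ _ ?_ h1 h2
    by_contra! hh
    exact hc (by ext i; fin_cases i <;> simp [hh, hu])
  have h12 : v 1 * w 2 = v 2 * w 1 := by
    obtain ⟨c, hc, hu, h1, h2⟩ := h 0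
    simp only [Fin.sum_univ_three, hu, zero_mul, zero_add] at h1 h2
    refine aux _ _ _ _ _ _ ?_ h1 h2
    by_contra! hh
    exact hc (by ext i; fin_cases i <;> simp [hh, hu])
  intro i j
  fin_cases i <;> fin_cases j <;> simp [h01, h02, h12]

theorem span_minors_eq {R : Type*} [CommRing R] {N : ℕ} (A : Matrix (Fin (N+1)) (Fin N) R) :
    Ideal.span { g | ∃ (r : Fin N → Fin (N+1)) (c : Fin N → Fin N),
      Function.Injective r ∧ Function.Injective c ∧ g = (A.submatrix r c).det } =
    Ideal.span (Set.range (sMinor A)) := by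
  apply le_antisymm
  · rw [Ideal.span_le]
    rintro _ ⟨r, c, hr, hc, rfl⟩
    obtain ⟨i, hi⟩ : ∃ i, i ∉ Set.range r := by
      by_contra! h
      have := Fintype.card_le_of_surjective r h
      simp at this
    have : ∀ k, ∃ l, i.succAbove l = r k := by
      intro k
      exact Fin.exists_succAbove_eq fun h => hi ⟨k, h⟩
    choose τ hτ using this
    have hτi : Function.Injective τ := fun a b h => hr (by rw [← hτ, ← hτ, h])
    let τ' := Equiv.ofBijective τ (Finite.injective_iff_bijective.1 hτi)
    let c' := Equiv.ofBijective c (Finite.injective_iff_bijective.1 hc)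
    have e1 : A.submatrix r c = (((A.submatrix i.succAbove id).submatrix τ' id).submatrix id c') := by
      ext a b; simp [τ', c', hτ]
    rw [e1, Matrix.det_permute', Matrix.det_permute]
    have hm : (A.submatrix i.succAbove id).det ∈ Ideal.span (Set.range (sMinor A)) := by
      have : (A.submatrix i.succAbove id).det = (-1)^(i:ℕ) * sMinor A i := by
        rw [sMinor, ← mul_assoc, ← mul_pow]; simp
      rw [this]
      exact Ideal.mul_mem_left _ _ (Ideal.subset_span ⟨i, rfl⟩)
    exact Ideal.mul_mem_left _ _ (Ideal.mul_mem_left _ _ hm)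
  · rw [Ideal.span_le]
    rintro _ ⟨i, rfl⟩
    refine Ideal.mul_mem_left _ _ (Ideal.subset_span ⟨i.succAbove, id, Fin.succAbove_right_injective, Function.injective_id, rfl⟩)

theorem sMinor_homog {K : Type*} [Field K] {N : ℕ}
    (A : Matrix (Fin (N+1)) (Fin N) (MvPolynomial (Fin 3) K)) (ε : Fin (N+1) → ℕ)
    (hA : ∀ i j, (A i j).IsHomogeneous (ε i)) (i : Fin (N+1)) :
    (sMinor A i).IsHomogeneous (∑ k, ε (i.succAbove k)) := by
  have h1 : ((A.submatrix i.succAbove id).det).IsHomogeneous (∑ k, ε (i.succAbove k)) := by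
    rw [Matrix.det_apply]
    refine IsHomogeneous.sum _ _ _ fun σ _ => ?_
    have h2 : (∏ k, (A.submatrix i.succAbove id) (σ k) k).IsHomogeneous (∑ k, ε (i.succAbove k)) := by
      rw [← Equiv.sum_comp σ (fun k => ε (i.succAbove k))]
      exact IsHomogeneous.prod _ _ _ fun k _ => hA _ _
    rcases Int.units_eq_one_or (Equiv.Perm.sign σ) with h | h <;> rw [h]
    · simpa using h2
    · simpa using h2.neg
  rw [sMinor]
  rcases neg_one_pow_eq_or (MvPolynomial (Fin 3) K) (i : ℕ) with h | h <;> rw [h]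
  · simpa using h1
  · simpa using h1.neg

/-- dehomogenization -/
def dehom {K : Type*} [Field K] (n : ℕ) (f : MvPolynomial (Fin 2) K) : Polynomial K :=
  ∑ i : Fin (n + 1), Polynomial.C (bcoeff n f i) * Polynomial.X ^ (i : ℕ)

theorem eval_binary {K : Type*} [Field K] {n : ℕ} {f : MvPolynomial (Fin 2) K}
    (hf : f.IsHomogeneous n) (v : Fin 2 → K) :
    eval v f = ∑ i : Fin (n + 1), bcoeff n f i * (v 0 ^ (n - (i : ℕ)) * v 1 ^ (i : ℕ)) := by
  classical
  let g : Fin (n + 1) → (Fin 2 →₀ ℕ) := fun i => Finsupp.single 0 (n - (i : ℕ)) + Finsupp.single 1 (i : ℕ)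
  have hg0 : ∀ i, g i 0 = n - (i : ℕ) := fun i => by simp [g]
  have hg1 : ∀ i, g i 1 = (i : ℕ) := fun i => by simp [g]
  have hg : Function.Injective g := by
    intro i j h
    apply Fin.ext
    rw [← hg1, ← hg1, h]
  have hsub : f.support ⊆ Finset.univ.image g := by
    intro d hd
    have hdeg : d.degree = n := by
      by_contra h
      exact (mem_support_iff.1 hd) (hf.coeff_eq_zero h)
    rw [Finsupp.degree_eq_sum, Fin.sum_univ_two] at hdeg
    refine Finset.mem_image.2 ⟨⟨d 1, by omega⟩, Finset.mem_univ _, ?_⟩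
    ext k
    fin_cases k
    · change g _ 0 = d 0
      rw [hg0]; simp; omega
    · change g _ 1 = d 1
      rw [hg1]
  rw [eval_eq', Finset.sum_subset hsub, Finset.sum_image hg.injOn]
  · refine Finset.sum_congr rfl fun i _ => ?_
    rw [Fin.prod_univ_two, hg0, hg1]; rfl
  · intro d _ hd
    rw [notMem_support_iff.1 hd, zero_mul]

theorem eval_dehom {K : Type*} [Field K] {n : ℕ} {f : MvPolynomial (Fin 2) K}
    (hf : f.IsHomogeneous n) (a : K) : (dehom n f).eval a = eval ![1, a] f := by
  rw [eval_binary hf, dehom, Polynomial.eval_finsetSum]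
  simp

theorem coeff_dehom {K : Type*} [Field K] {n : ℕ} {f : MvPolynomial (Fin 2) K}
    (hf : f.IsHomogeneous n) : (dehom n f).coeff n = eval ![0, 1] f := by
  rw [eval_binary hf, dehom, Polynomial.finsetSum_coeff, Fin.sum_univ_castSucc, Fin.sum_univ_castSucc]
  congr 1
  · rw [Finset.sum_eq_zero, Finset.sum_eq_zero]
    · intro i _
      have : n - (i : ℕ) ≠ 0 := by have := i.isLt; omega
      simp [this]
    · intro i _
      have : n ≠ (i : ℕ) := by have := i.isLt; omega
      simp [Polynomial.coeff_X_pow, this]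
  · simp

/-- The quadratic polynomial of a coefficient vector. -/
def quad {K : Type*} [Field K] (x : Fin 3 → K) : Polynomial K :=
  Polynomial.C (x 0) + Polynomial.C (x 1) * Polynomial.X + Polynomial.C (x 2) * Polynomial.X ^ 2

theorem quad_coeff {K : Type*} [Field K] (x : Fin 3 → K) (k : ℕ) :
    (quad x).coeff k = if h : k < 3 then x ⟨k, h⟩ else 0 := by
  simp only [quad, Polynomial.coeff_add, Polynomial.coeff_C, Polynomial.coeff_C_mul, Polynomial.coeff_X,
    Polynomial.coeff_X_pow]
  split_ifs with h1 h2 h3 h4 h5 <;> first | omega | (subst_vars; simp)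

abbrev MM {K : Type*} [Field K] (m : ℕ) (f : Fin 3 → MvPolynomial (Fin 2) K) :
    Matrix (Fin (m + 3 + 1)) (Fin (m + 3)) (MvPolynomial (Fin 3) K) := Mmat (m + 2) 2 f

theorem row_stair {K : Type*} [Field K] (m : ℕ) (f : Fin 3 → MvPolynomial (Fin 2) K) (x : Fin 3 → K)
    (j : Fin (m + 1)) :
    ∑ k : Fin (m + 3), Polynomial.C (eval x (MM m f (Fin.castAdd 3 j) k)) * Polynomial.X ^ (k : ℕ)
      = Polynomial.X ^ (j : ℕ) * quad x := by
  ext k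
  have hj := j.isLt
  rw [Polynomial.finsetSum_coeff, Polynomial.coeff_X_pow_mul', quad_coeff]
  simp only [Polynomial.coeff_C_mul, Polynomial.coeff_X_pow]
  by_cases hk : k < m + 3
  · rw [Finset.sum_eq_single ⟨k, hk⟩]
    · have h1 : (j : ℕ) ≤ m + 2 - 2 := by omega
      simp only [MM, Mmat, Fin.val_castAdd, h1, dite_true, if_true, mul_one]
      by_cases h2 : (j : ℕ) ≤ k
      · by_cases h3 : k ≤ j + 2
        · rw [dif_pos ⟨h2, h3⟩, if_pos h2, dif_pos (by omega), eval_X]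
        · rw [dif_neg (fun h => h3 h.2), if_pos h2, dif_neg (by omega), map_zero]
      · rw [dif_neg (fun h => h2 h.1), if_neg h2, map_zero]
    · intro b _ hb
      rw [if_neg (fun h => hb (Fin.ext h.symm)), mul_zero]
    · simp
  · rw [Finset.sum_eq_zero]
    · split_ifs <;> first | rfl | omega
    · intro i _
      have := i.isLt
      rw [if_neg (by omega), mul_zero]

theorem row_f {K : Type*} [Field K] (m : ℕ) (f : Fin 3 → MvPolynomial (Fin 2) K) (x : Fin 3 → K)
    (u : Fin 3) :
    ∑ k : Fin (m + 3), Polynomial.C (eval x (MM m f (Fin.natAdd (m+1) u) k)) * Polynomial.X ^ (k : ℕ)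
      = dehom (m + 2) (f u) := by
  rw [dehom]
  refine Finset.sum_congr rfl fun k _ => ?_
  have h1 : ¬ (m + 1 + (u : ℕ) ≤ m + 2 - 2) := by omega
  simp only [MM, Mmat, Fin.val_natAdd, h1, dite_false, eval_C]
  congr 4
  apply Fin.ext
  simp

theorem MM_kernel {K : Type*} [Field K] (m : ℕ) (f : Fin 3 → MvPolynomial (Fin 2) K) (x : Fin 3 → K)
    (hx : x ≠ 0) (hz : ∀ i, eval x (sMinor (MM m f) i) = 0) (u : Fin 3) :
    ∃ c : Fin 3 → K, c ≠ 0 ∧ c u = 0 ∧ ∃ H : Polynomial K, H.natDegree ≤ m ∧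
      ∑ i, Polynomial.C (c i) * dehom (m + 2) (f i) = H * quad x := by
  have hquad : quad x ≠ 0 := by
    intro h
    apply hx
    ext k
    have := quad_coeff x k
    rw [h] at this
    simpa using this.symm
  let A : Matrix (Fin (m + 3 + 1)) (Fin (m + 3)) K := (MM m f).map (eval x)
  let i0 : Fin (m + 3 + 1) := Fin.natAdd (m + 1) u
  have hdet : (A.submatrix i0.succAbove id).det = 0 := by
    have h1 := hz i0
    rw [sMinor, map_mul, RingHom.map_det] at h1
    have h2 : (eval x) ((-1) ^ (i0 : ℕ)) ≠ (0 : K) := by simp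
    exact (mul_eq_zero.1 h1).resolve_left h2
  obtain ⟨v, hv0, hv⟩ := Matrix.exists_vecMul_eq_zero_iff.2 hdet
  let y : Fin (m + 3 + 1) → K := i0.insertNth (α := fun _ => K) 0 v
  have hy0 : y i0 = 0 := by simp [y]
  have hyv : ∀ k, y (i0.succAbove k) = v k := fun k => by simp [y]
  have hy : ∀ k, ∑ j, y j * A j k = 0 := by
    intro k
    rw [Fin.sum_univ_succAbove _ i0, hy0, zero_mul, zero_add]
    simp only [hyv]
    exact congrFun hv k
  have hrow : ∑ j, Polynomial.C (y j) * (∑ k : Fin (m + 3), Polynomial.C (A j k) * Polynomial.X ^ (k : ℕ)) = 0 := by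
    simp only [Finset.mul_sum]
    rw [Finset.sum_comm]
    refine Finset.sum_eq_zero fun k _ => ?_
    simp only [← mul_assoc, ← Finset.sum_mul, ← Polynomial.C_mul, ← map_sum, hy k]
    simp
  have hsplit := Fin.sum_univ_add (a := m + 1) (b := 3) (fun j => Polynomial.C (y j) * (∑ k : Fin (m + 3), Polynomial.C (A j k) * Polynomial.X ^ (k : ℕ)))
  have hsplit := hsplit.symm.trans hrow
  have e1 : ∀ j : Fin (m + 1), ∑ k : Fin (m + 3), Polynomial.C (A (Fin.castAdd 3 j) k) * Polynomial.X ^ (k : ℕ)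
     = Polynomial.X ^ (j : ℕ) * quad x := row_stair m f x
  have e2 : ∀ u : Fin 3, ∑ k : Fin (m + 3), Polynomial.C (A (Fin.natAdd (m+1) u) k) * Polynomial.X ^ (k : ℕ)
     = dehom (m + 2) (f u) := row_f m f x
  simp only [e1, e2] at hsplit
  let H : Polynomial K := - ∑ j : Fin (m + 1), Polynomial.C (y (Fin.castAdd 3 j)) * Polynomial.X ^ (j : ℕ)
  have hH : ∑ i : Fin 3, Polynomial.C (y (Fin.natAdd (m+1) i)) * dehom (m + 2) (f i) = H * quad x := by
    simp only [H, neg_mul, Finset.sum_mul, mul_assoc]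
    exact eq_neg_of_add_eq_zero_right hsplit
  refine ⟨fun i => y (Fin.natAdd (m+1) i), ?_, hy0, H, ?_, hH⟩
  · intro hc
    have hc' : ∀ i : Fin 3, y (Fin.natAdd (m+1) i) = 0 := fun i => congrFun hc i
    simp only [hc', map_zero, zero_mul, Finset.sum_const_zero] at hH
    have hH0 := (mul_eq_zero.1 hH.symm).resolve_right hquad
    have hyz : ∀ j, y j = 0 := by
      intro j
      refine Fin.addCases (m := m + 1) (n := 3) (motive := fun j => y j = 0) (fun j => ?_) hc' j
      have := congrArg (fun P => Polynomial.coeff P (j : ℕ)) hH0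
      simp only [H, Polynomial.coeff_neg, Polynomial.finsetSum_coeff, Polynomial.coeff_C_mul,
        Polynomial.coeff_X_pow, Polynomial.coeff_zero, neg_eq_zero] at this
      rw [Finset.sum_eq_single j] at this
      · simpa using this
      · intro b _ hb
        rw [if_neg (fun h => hb (Fin.ext h.symm)), mul_zero]
      · simp
    exact hv0 (funext fun k => by rw [← hyv, hyz]; rfl)
  · rw [Polynomial.natDegree_neg]
    refine Polynomial.natDegree_sum_le_of_forall_le _ _ fun j _ => ?_
    exact (Polynomial.natDegree_C_mul_X_pow_le _ _).trans (by have := j.isLt; omega)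

theorem functional_parallel {K : Type*} [Field K] (m : ℕ) (f : Fin 3 → MvPolynomial (Fin 2) K) (x : Fin 3 → K)
    (hx : x ≠ 0) (hz : ∀ i, eval x (sMinor (MM m f) i) = 0) (l l' : Polynomial K →ₗ[K] K)
    (hl : ∀ H : Polynomial K, H.natDegree ≤ m → l (H * quad x) = 0)
    (hl' : ∀ H : Polynomial K, H.natDegree ≤ m → l' (H * quad x) = 0) (i j : Fin 3) :
    l (dehom (m + 2) (f i)) * l' (dehom (m + 2) (f j)) =
      l (dehom (m + 2) (f j)) * l' (dehom (m + 2) (f i)) := by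
  refine parallel_of (fun i => l (dehom (m + 2) (f i))) (fun i => l' (dehom (m + 2) (f i))) ?_ i j
  intro u
  obtain ⟨c, hc, hu, H, hH, he⟩ := MM_kernel m f x hx hz u
  refine ⟨c, hc, hu, ?_, ?_⟩
  · rw [← hl H hH, ← he, map_sum]
    refine Finset.sum_congr rfl fun i _ => ?_
    rw [← Polynomial.smul_eq_C_mul, map_smul, smul_eq_mul]
  · rw [← hl' H hH, ← he, map_sum]
    refine Finset.sum_congr rfl fun i _ => ?_
    rw [← Polynomial.smul_eq_C_mul, map_smul, smul_eq_mul]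

theorem trichotomy {K : Type*} [Field K] (m : ℕ) (f : Fin 3 → MvPolynomial (Fin 2) K) (x : Fin 3 → K)
    (hx : x ≠ 0) (hz : ∀ i, eval x (sMinor (MM m f) i) = 0) (a : K)
    (ha : x 0 + x 1 * a + x 2 * a ^ 2 = 0) :
    (∃ b, b ≠ a ∧ ∀ i j, (dehom (m + 2) (f i)).eval a * (dehom (m + 2) (f j)).eval b =
      (dehom (m + 2) (f j)).eval a * (dehom (m + 2) (f i)).eval b) ∨
    (∀ i j, (dehom (m + 2) (f i)).eval a * (dehom (m + 2) (f j)).coeff (m + 2) =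
      (dehom (m + 2) (f j)).eval a * (dehom (m + 2) (f i)).coeff (m + 2)) ∨
    (∀ i j, (dehom (m + 2) (f i)).eval a * (Polynomial.derivative (dehom (m + 2) (f j))).eval a =
      (dehom (m + 2) (f j)).eval a * (Polynomial.derivative (dehom (m + 2) (f i))).eval a) := by
  have hev : ∀ b, (quad x).eval b = x 0 + x 1 * b + x 2 * b ^ 2 := by intro b; simp [quad]
  have hroot : ∀ b, x 0 + x 1 * b + x 2 * b ^ 2 = 0 → ∀ H : Polynomial K, H.natDegree ≤ m →
      Polynomial.leval b (H * quad x) = 0 := by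
    intro b hb H _
    simp [Polynomial.leval, hev, hb]
  by_cases h2 : x 2 = 0
  · right; left
    intro i j
    refine functional_parallel m f x hx hz (Polynomial.leval a) (Polynomial.lcoeff K (m + 2)) (hroot a ha) ?_ i j
    intro H hH
    rw [Polynomial.lcoeff_apply]
    apply Polynomial.coeff_eq_zero_of_natDegree_lt
    have hq : (quad x).natDegree ≤ 1 := by
      rw [quad, h2, Polynomial.C_0, zero_mul, add_zero]
      compute_degree
    have := Polynomial.natDegree_mul_le (p := H) (q := quad x)
    omega
  · set b := - (x 1 + a * x 2) / x 2 with hb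
    have hb' : x 2 * b = - (x 1 + a * x 2) := by rw [hb]; field_simp
    by_cases hba : b = a
    · right; right
      intro i j
      refine functional_parallel m f x hx hz (Polynomial.leval a)
        (Polynomial.leval a ∘ₗ Polynomial.derivative) (hroot a ha) ?_ i j
      intro H hH
      rw [hba] at hb'
      simp only [LinearMap.comp_apply, Polynomial.leval_apply, Polynomial.derivative_mul, Polynomial.eval_add,
        Polynomial.eval_mul, hev, ha]
      simp [quad]
      right
      linear_combination hb'
    · left
      refine ⟨b, hba, fun i j => ?_⟩
      refine functional_parallel m f x hx hz (Polynomial.leval a)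
        (Polynomial.leval b) (hroot a ha) (hroot b ?_) i j
      linear_combination ha + (b - a) * hb'

theorem projMap_mk {K : Type*} [Field K] {n : ℕ} {f : Fin 3 → MvPolynomial (Fin 2) K}
    (hf : IsProperParam n f) (v : Fin 2 → K) (hv : v ≠ 0) :
    projMap f (Projectivization.mk K v hv) = Projectivization.mk K (evalVec f v) (hf.no_common_zero v hv) := by
  have hr := hf.no_common_zero _ (Projectivization.rep_nonzero (Projectivization.mk K v hv))
  rw [projMap, dif_pos hr, Projectivization.mk_eq_mk_iff']
  obtain ⟨t, ht⟩ := Projectivization.exists_smul_eq_mk_rep K v hv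
  refine ⟨(t : K) ^ n, ?_⟩
  rw [← ht]
  ext u
  exact (homog_eval_smul (hf.homog u) (t : K) v).symm

theorem mk_eq_of_parallel {K ι : Type*} [Field K] (v w : ι → K) (hv : v ≠ 0) (hw : w ≠ 0)
    (h : ∀ i j, v i * w j = v j * w i) : Projectivization.mk K v hv = Projectivization.mk K w hw := by
  rw [Projectivization.mk_eq_mk_iff']
  obtain ⟨j, hj⟩ := Function.ne_iff.1 hw
  have hj : w j ≠ 0 := hj
  refine ⟨v j / w j, ?_⟩
  ext i
  simp only [Pi.smul_apply, smul_eq_mul]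
  field_simp
  linear_combination -(h i j)

theorem vec_ne {K : Type*} [Field K] (a : K) : ![1, a] ≠ (0 : Fin 2 → K) := fun h => by
  simpa using congrFun h 0

theorem vec_ne' {K : Type*} [Field K] : ![0, 1] ≠ (0 : Fin 2 → K) := fun h => by
  simpa using congrFun h 1

theorem pt_inj {K : Type*} [Field K] (a b : K)
    (h : Projectivization.mk K ![1, a] (vec_ne a) = Projectivization.mk K ![1, b] (vec_ne b)) : a = b := by
  rw [Projectivization.mk_eq_mk_iff'] at h
  obtain ⟨t, ht⟩ := h
  have h0 := congrFun ht 0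
  have h1 := congrFun ht 1
  simp at h0 h1
  rw [h0, one_mul] at h1
  exact h1.symm

/-- parameters which collide with another point -/
def badSet {K : Type*} [Field K] (f : Fin 3 → MvPolynomial (Fin 2) K) : Set K :=
  {a | ∃ (v : Fin 2 → K) (hv : v ≠ 0), Projectivization.mk K v hv ≠ Projectivization.mk K ![1, a] (vec_ne a) ∧
    ∀ i j, eval ![1, a] (f i) * eval v (f j) = eval ![1, a] (f j) * eval v (f i)}

theorem badSet_finite {K : Type*} [Field K] {n : ℕ} {f : Fin 3 → MvPolynomial (Fin 2) K}
    (hf : IsProperParam n f) : (badSet f).Finite := by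
  obtain ⟨S, hS, hinj⟩ := hf.gen_injective
  let pt : K → Projectivization K (Fin 2 → K) := fun a => Projectivization.mk K ![1, a] (vec_ne a)
  have hpt : Function.Injective pt := fun a b h => pt_inj a b h
  have h1 : (pt ⁻¹' S).Finite := hS.preimage hpt.injOn
  have h2 : (badSet f \ pt ⁻¹' S).Finite := by
    refine Set.Finite.of_finite_image (f := fun a => projMap f (pt a)) ?_ ?_
    · refine (hS.image (projMap f)).subset ?_
      rintro _ ⟨a, ⟨⟨v, hv, hne, hpar⟩, haS⟩, rfl⟩
      have heq : projMap f (pt a) = projMap f (Projectivization.mk K v hv) := by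
        rw [projMap_mk hf, projMap_mk hf]
        exact mk_eq_of_parallel _ _ _ _ hpar
      refine ⟨Projectivization.mk K v hv, ?_, heq.symm⟩
      by_contra hvS
      exact hne (hinj haS hvS heq).symm
    · intro a ha b hb h
      exact hpt (hinj ha.2 hb.2 h)
  exact (h1.union h2).subset fun a ha => by
    by_cases h : a ∈ pt ⁻¹' S
    · exact Or.inl h
    · exact Or.inr ⟨ha, h⟩

theorem not_all_vanish {K : Type*} [Field K] [CharZero K] (m : ℕ)
    {f : Fin 3 → MvPolynomial (Fin 2) K} (hf : IsProperParam (m + 2) f)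
    (h : ∀ a : K, ∃ x : Fin 3 → K, x ≠ 0 ∧ x 0 + x 1 * a + x 2 * a ^ 2 = 0 ∧
      ∀ i, eval x (sMinor (MM m f) i) = 0) : False := by
  have hfin := badSet_finite hf
  have hram : ∀ a, a ∉ badSet f → ∀ i j, (dehom (m + 2) (f i)).eval a * (Polynomial.derivative (dehom (m + 2) (f j))).eval a =
      (dehom (m + 2) (f j)).eval a * (Polynomial.derivative (dehom (m + 2) (f i))).eval a := by
    intro a ha
    obtain ⟨x, hx, hxa, hz⟩ := h a
    rcases trichotomy m f x hx hz a hxa with ⟨b, hb, h1⟩ | h1 | h1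
    · exfalso; apply ha
      refine ⟨![1, b], vec_ne b, fun h => hb (pt_inj _ _ h), ?_⟩
      simpa only [eval_dehom (hf.homog _)] using h1
    · exfalso; apply ha
      refine ⟨![0, 1], vec_ne', ?_, ?_⟩
      · rw [ne_eq, Projectivization.mk_eq_mk_iff']
        rintro ⟨t, ht⟩
        have h0 := congrFun ht 0
        have h1 := congrFun ht 1
        simp at h0 h1
        simp [h0] at h1
      · simpa only [eval_dehom (hf.homog _), coeff_dehom (hf.homog _)] using h1
    · exact h1
  have hW : ∀ i j, dehom (m + 2) (f i) * Polynomial.derivative (dehom (m + 2) (f j)) =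
      dehom (m + 2) (f j) * Polynomial.derivative (dehom (m + 2) (f i)) := by
    intro i j
    rw [← sub_eq_zero]
    refine Polynomial.eq_zero_of_infinite_isRoot _ (Set.Infinite.mono ?_ hfin.infinite_compl)
    intro a ha
    change Polynomial.eval a _ = 0
    rw [Polynomial.eval_sub, Polynomial.eval_mul, Polynomial.eval_mul, hram a ha i j, sub_self]
  obtain ⟨j, hj⟩ := Function.ne_iff.1 (hf.no_common_zero ![1, 0] (vec_ne 0))
  have hj : (dehom (m + 2) (f j)).eval 0 ≠ 0 := by
    rw [eval_dehom (hf.homog _)]; exact hj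
  have hprop := fun i => wronskian_zero _ _ (hW j i) 0 hj
  refine (Set.finite_singleton (0 : K)).infinite_compl (hfin.subset ?_)
  intro a ha
  refine ⟨![1, 0], vec_ne 0, fun h => ha (pt_inj _ _ h).symm, fun i k => ?_⟩
  simp only [← eval_dehom (hf.homog _)]
  have hi := congrArg (Polynomial.eval a) (hprop i)
  have hk := congrArg (Polynomial.eval a) (hprop k)
  simp only [Polynomial.eval_mul, Polynomial.eval_C] at hi hk
  apply mul_left_cancel₀ hj
  linear_combination (dehom (m + 2) (f k)).eval 0 * hi - (dehom (m + 2) (f i)).eval 0 * hk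

/-- row degrees -/
def rowDeg (m : ℕ) (i : Fin (m + 3 + 1)) : ℕ := if (i : ℕ) ≤ m then 1 else 0

theorem MM_homog {K : Type*} [Field K] (m : ℕ) (f : Fin 3 → MvPolynomial (Fin 2) K)
    (i : Fin (m + 3 + 1)) (j : Fin (m + 3)) : (MM m f i j).IsHomogeneous (rowDeg m i) := by
  simp only [MM, Mmat, rowDeg]
  by_cases h : (i : ℕ) ≤ m
  · rw [dif_pos (by omega), if_pos h]
    split_ifs
    · exact isHomogeneous_X _ _
    · exact isHomogeneous_zero _ _ _
  · rw [dif_neg (by omega), if_neg h]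
    exact isHomogeneous_C _ _

theorem rowDeg_sum (m : ℕ) (φ : ℕ → ℕ) : ∑ i, φ (rowDeg m i) = (m + 1) * φ 1 + 3 * φ 0 := by
  rw [show (∑ i : Fin (m + 3 + 1), φ (rowDeg m i)) = ∑ i : Fin (m + 1 + 3), φ (rowDeg m i) from rfl]
  rw [Fin.sum_univ_add]
  congr 1
  · rw [Finset.sum_congr rfl (g := fun _ => φ 1)]
    · simp
    · intro i _
      have := i.isLt
      rw [rowDeg, if_pos]
      rw [Fin.val_castAdd]; omega
  · rw [Finset.sum_congr rfl (g := fun _ => φ 0)]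
    · simp
    · intro i _
      rw [rowDeg, if_neg]
      rw [Fin.val_natAdd]; omega

theorem minors_coprime {K : Type*} [Field K] [IsAlgClosed K] [CharZero K] (m : ℕ)
    {f : Fin 3 → MvPolynomial (Fin 2) K} (hf : IsProperParam (m + 2) f) (p : MvPolynomial (Fin 3) K)
    (hp : Prime p) : ∃ k, ¬ p ∣ sMinor (MM m f) k := by
  by_contra! hall
  have hdeg : p.totalDegree ≠ 0 := by
    intro h0
    rw [totalDegree_eq_zero_iff_eq_C] at h0
    apply hp.not_isUnit
    have : coeff 0 p ≠ 0 := fun h => hp.ne_zero (by rw [h0, h, C_0])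
    rw [h0]
    exact (isUnit_iff_ne_zero.2 this).map C
  refine not_all_vanish m hf fun a => ?_
  obtain ⟨β, γ, hne, hz⟩ := line_zero (homogeneousComponent_isHomogeneous p.totalDegree p) hdeg
    ![-a, 1, 0] ![0, -a, 1]
  refine ⟨β • ![-a, 1, 0] + γ • ![0, -a, 1], ?_, ?_, ?_⟩
  · intro h
    have h1 := congrFun h 1
    have h2 := congrFun h 2
    simp at h1 h2
    simp [h2] at h1 hne
    exact hne h1
  · simp; ring
  · intro i
    obtain ⟨q, hq⟩ := top_dvd (sMinor_homog (MM m f) (rowDeg m) (MM_homog m f) i) (hall i)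
    rw [hq, map_mul, hz, zero_mul]

theorem span_minors {K : Type*} [Field K] (m : ℕ) (f : Fin 3 → MvPolynomial (Fin 2) K) :
    Ideal.span (minorsSet (m + 2) 2 f) = Ideal.span (Set.range (sMinor (MM m f))) :=
  span_minors_eq (MM m f)

theorem two_mul_choose (k : ℕ) : 2 * (k + 2).choose 2 = (k + 2) * (k + 1) := by
  rw [Nat.choose_two_right, Nat.mul_div_cancel']
  · rfl
  · simpa [mul_comm] using (Nat.even_mul_succ_self (k + 1)).two_dvd

theorem length_eq {K : Type*} [Field K] [IsAlgClosed K] [CharZero K] (m : ℕ)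
    {f : Fin 3 → MvPolynomial (Fin 2) K} (hf : IsProperParam (m + 2) f) (d : ℕ) (hd : m + 1 ≤ d) :
    Module.finrank K (Submodule.span K
        ((Ideal.Quotient.mk (Ideal.span (minorsSet (m + 2) 2 f))) ''
          { g : MvPolynomial (Fin 3) K | g.IsHomogeneous d })) = (m + 1) * m / 2 := by
  rw [span_minors]
  obtain ⟨e, rfl⟩ : ∃ e, d = e + (m + 1) := ⟨d - (m + 1), by omega⟩
  have hcop := minors_coprime m hf
  have hne : ∃ i, sMinor (MM m f) i ≠ 0 := by
    obtain ⟨k, hk⟩ := hcop (X 0) (X_prime)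
    exact ⟨k, fun h => hk (by rw [h]; exact dvd_zero _)⟩
  have hsum := rowDeg_sum m id
  have key := dim_count (D := m + 1) (MM m f) (rowDeg m) (fun i => ∑ k, rowDeg m (i.succAbove k)) (MM_homog m f)
    (sMinor_homog _ _ (MM_homog m f)) (fun i => by
      rw [add_comm, ← Fin.sum_univ_succAbove]
      simpa using hsum) hne hcop e
  rw [rowDeg_sum m (fun t => (e + t + 2).choose 2)] at key
  set r := Module.finrank K (Submodule.span K
        ((Ideal.Quotient.mk (Ideal.span (Set.range (sMinor (MM m f))))) ''
          { g : MvPolynomial (Fin 3) K | g.IsHomogeneous (e + (m + 1)) })) with hr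
  clear_value r
  have t1 := two_mul_choose (e + 1)
  have t2 := two_mul_choose e
  have t3 := two_mul_choose (e + (m + 1))
  simp only [add_zero] at key
  have : 2 * r = (m + 1) * m := by
    zify at key t1 t2 t3 ⊢
    linear_combination 2 * key - (m + 1) * t1 - 3 * t2 + t3 + (m + 3) * t2
  omega

theorem Xk_nonempty {K : Type*} [Field K] [IsAlgClosed K] [CharZero K] (m : ℕ) (hm : 1 ≤ m)
    {f : Fin 3 → MvPolynomial (Fin 2) K} (hf : IsProperParam (m + 2) f) :
    (XkSet (m + 2) 2 f).Nonempty := by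
  by_contra hemp
  rw [Set.not_nonempty_iff_eq_empty] at hemp
  set I := Ideal.span (minorsSet (m + 2) 2 f) with hI
  have hz : ∀ x ∈ zeroLocus K I, x = 0 := by
    intro x hx
    by_contra hx0
    have : Projectivization.mk K x hx0 ∈ XkSet (m + 2) 2 f := by
      have hS : ∀ i, eval x (sMinor (MM m f) i) = 0 := by
        intro i
        have := hx (sMinor (MM m f) i) (by
          rw [hI, span_minors]; exact Ideal.subset_span ⟨i, rfl⟩)
        simpa [aeval_eq_eval] using this
      obtain ⟨t, ht⟩ := Projectivization.exists_smul_eq_mk_rep K x hx0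
      intro g hg
      have hle : Ideal.span (Set.range (sMinor (MM m f))) ≤
          RingHom.ker (eval (Projectivization.mk K x hx0).rep) := by
        rw [Ideal.span_le]
        rintro _ ⟨i, rfl⟩
        rw [SetLike.mem_coe, RingHom.mem_ker, ← ht]
        have := homog_eval_smul (sMinor_homog (MM m f) (rowDeg m) (MM_homog m f) i) (t : K) x
        rw [hS i, mul_zero] at this
        exact this
      rw [← span_minors] at hle
      exact hle (Ideal.subset_span hg)
    rw [hemp] at this
    exact this
  have hrad : idealOfVars (Fin 3) K ≤ I.radical := by
    rw [← vanishingIdeal_zeroLocus_eq_radical (K := K), idealOfVars, Ideal.span_le]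
    rintro _ ⟨i, rfl⟩
    intro x hx
    rw [hz x hx]; simp
  obtain ⟨N, hN⟩ := Ideal.exists_pow_le_of_le_radical_of_fg hrad (idealOfVars_fg _ _)
  have hlen := length_eq m hf (N + m + 1) (by omega)
  have hbot : Submodule.span K ((Ideal.Quotient.mk I) ''
          { g : MvPolynomial (Fin 3) K | g.IsHomogeneous (N + m + 1) }) = ⊥ := by
    rw [Submodule.span_eq_bot]
    rintro _ ⟨g, hg, rfl⟩
    rw [Ideal.Quotient.eq_zero_iff_mem]
    apply hN
    rw [mem_pow_idealOfVars_iff]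
    intro d hd
    have hdeg : d.degree = N + m + 1 := by
      by_contra h
      exact (mem_support_iff.1 hd) (IsHomogeneous.coeff_eq_zero hg h)
    omega
  rw [hbot, finrank_bot] at hlen
  have : 2 ≤ (m + 1) * m := by nlinarith
  omega

/-- `X_2(K)` is nonempty and the scheme `X_2` has length `(n-1)(n-2)/2`: for all large `d`,
the degree-`d` homogeneous component of `K[x_0,x_1,x_2]/I_{X_2}` has `K`-dimension
`(n-1)(n-2)/2`. -/
theorem statement_1 {K : Type*} [Field K] [IsAlgClosed K] [CharZero K]
    (n : ℕ) (hn : 3 ≤ n) (f : Fin 3 → MvPolynomial (Fin 2) K)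
    (hf : IsProperParam n f) :
    (XkSet n 2 f).Nonempty ∧
    ∃ d0 : ℕ, ∀ d : ℕ, d0 ≤ d →
      Module.finrank K (Submodule.span K
        ((Ideal.Quotient.mk (Ideal.span (minorsSet n 2 f))) ''
          { g : MvPolynomial (Fin 3) K | g.IsHomogeneous d }))
        = (n - 1) * (n - 2) / 2 := by
  obtain ⟨m, rfl⟩ : ∃ m, n = m + 2 := ⟨n - 2, by omega⟩
  exact ⟨Xk_nonempty m (by omega) hf, m + 1, fun d hd => length_eq m hf d hd⟩

end
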